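/- Let s₂(n) denote the sum of the binary digits of the natural number n, let j := exp(2πi/3) ∈ ℂ, and define u : ℕ → ℂ by u(n) := (-1)^{s₂(n)} · j^n. Then for every natural number m, ∑_{k < 4^m} u(k) = 3^m. (Thus joining the points ∑_{k<N} u(k) gives a non-renormalized von Koch curve whose endpoint after 4^m steps is the real number 3^m.) -/

import Mathlib

/-- Sum of the binary digits of `n`. -/
def s2 (n : ℕ) : ℕ := (Nat.digits 2 n).sum

/-- The primitive cube root of unity `j = exp(2πi/3)`. -/
noncomputable def jc : ℂ := Complex.exp (2 * Real.pi * Complex.I / 3)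

/-- The sequence `u n = (-1)^{s₂(n)} j^n`. -/
noncomputable def u (n : ℕ) : ℂ := (-1) ^ s2 n * jc ^ n

theorem s2_even (n : ℕ) : s2 (2 * n) = s2 n := by
  unfold s2
  rcases Nat.eq_zero_or_pos n with h | h
  · subst h; simp
  · rw [Nat.digits_def' (by norm_num) (by omega)]
    simp

theorem s2_odd (n : ℕ) : s2 (2 * n + 1) = s2 n + 1 := by
  unfold s2
  rw [Nat.digits_def' (by norm_num) (by omega)]
  have h1 : (2 * n + 1) % 2 = 1 := by omega
  have h2 : (2 * n + 1) / 2 = n := by omega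
  rw [h1, h2, List.sum_cons, add_comm]

theorem jc_prim : IsPrimitiveRoot jc 3 := by
  have h := Complex.isPrimitiveRoot_exp 3 (by norm_num)
  simpa [jc] using h

theorem jc_cube : jc ^ 3 = 1 := jc_prim.pow_eq_one

theorem jc_sum : 1 + jc + jc ^ 2 = 0 := by
  have h := jc_prim.geom_sum_eq_zero (by norm_num)
  simpa [Finset.sum_range_succ] using h

theorem u_block (q : ℕ) :
    u (4 * q) + u (4 * q + 1) + u (4 * q + 2) + u (4 * q + 3) = 3 * u q := by
  have e0 : s2 (4 * q) = s2 q := by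
    rw [show 4 * q = 2 * (2 * q) by ring, s2_even, s2_even]
  have e1 : s2 (4 * q + 1) = s2 q + 1 := by
    rw [show 4 * q + 1 = 2 * (2 * q) + 1 by ring, s2_odd, s2_even]
  have e2 : s2 (4 * q + 2) = s2 q + 1 := by
    rw [show 4 * q + 2 = 2 * (2 * q + 1) by ring, s2_even, s2_odd]
  have e3 : s2 (4 * q + 3) = s2 q + 1 + 1 := by
    rw [show 4 * q + 3 = 2 * (2 * q + 1) + 1 by ring, s2_odd, s2_odd]
  have hj : jc ^ (4 * q) = jc ^ q := by
    rw [show 4 * q = 3 * q + q by ring, pow_add, pow_mul, jc_cube, one_pow, one_mul]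
  simp only [u, e0, e1, e2, e3, pow_add, hj, jc_cube]
  linear_combination (-(-1) ^ s2 q * jc ^ q) * jc_sum

theorem sum_block (f : ℕ → ℂ) (N : ℕ) :
    ∑ k ∈ Finset.range (4 * N), f k =
      ∑ q ∈ Finset.range N, (f (4 * q) + f (4 * q + 1) + f (4 * q + 2) + f (4 * q + 3)) := by
  induction N with
  | zero => simp
  | succ n ih =>
    rw [Finset.sum_range_succ, ← ih, show 4 * (n + 1) = 4 * n + 1 + 1 + 1 + 1 by ring]
    simp only [Finset.sum_range_succ]
    ring

theorem stmt_3 (m : ℕ) :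
    ∑ k ∈ Finset.range (4 ^ m), u k = (3 : ℂ) ^ m := by
  induction m with
  | zero => simp [u, s2]
  | succ m ih =>
    rw [pow_succ', sum_block]
    simp only [u_block]
    rw [← Finset.mul_sum, ih, pow_succ']
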